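/- arXiv:2401.15571 — 2 statements merged into one kernel-verified Lean document; each statement's English description precedes it below -/
import Mathlib

section
/- Let t and r be positive integers and set q = 2^r. Then there exists a dictionary D in ℝ^(q^(2t)) (a finite family of unit vectors spanning ℝ^(q^(2t))) which is a union of q+1 orthonormal bases of ℝ^(q^(2t)), whose spark equals q^t + q^(t-1) and whose mutual coherence equals 1/q^t. In particular the spark of D attains the Gribonval–Nielsen lower bound η(D) ≥ (1 + 1/q)·(1/μ(D)) for unions of q+1 orthonormal bases. -/
open scoped RealInnerProductSpace

lemma spark_lb {ι J E : Type*} [Fintype ι] [DecidableEq ι] [DecidableEq J]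
    [NormedAddCommGroup E] [InnerProductSpace ℝ E] (D : ι × J → E)
    (ho : ∀ i, Orthonormal ℝ (fun j => D (i, j))) (μ q : ℝ) (hμ0 : 0 ≤ μ) (hq : 0 < q)
    (hμ : ∀ p p', p.1 ≠ p'.1 → |⟪D p, D p'⟫| ≤ μ) (hc : (Fintype.card ι : ℝ) = q + 1)
    (s : Finset (ι × J)) (hs : μ * s.card < (q + 1) / q) :
    LinearIndependent ℝ (fun i : s => D i) := by
  have : LinearIndepOn ℝ D (s : Set (ι × J)) := by
    rw [linearIndepOn_finset_iff]
    intro f hf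
    set S : ι → ℝ := fun l => ∑ p ∈ s with p.1 = l, |f p| with hS
    set T : ℝ := ∑ p ∈ s, |f p| with hT
    have hST : ∑ l, S l = T := by
      simp only [hS, hT]
      exact Finset.sum_fiberwise s (fun p => p.1) (fun p => |f p|)
    have hcard : ∑ l, (({p ∈ s | p.1 = l}.card : ℕ) : ℝ) = s.card := by
      have := Finset.sum_fiberwise s (fun p => p.1) (fun p => (1:ℝ))
      simpa using this
    have hS0 : ∀ l, 0 ≤ S l := fun l => Finset.sum_nonneg fun _ _ => abs_nonneg _
    have hbound : ∀ p ∈ s, |f p| ≤ μ * (T - S p.1) := by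
      intro p hp
      have h1 : ∑ p' ∈ s, f p' * ⟪D p, D p'⟫ = 0 := by
        have := congrArg (fun v => ⟪D p, v⟫) hf
        simpa [inner_sum, inner_smul_right] using this
      rw [← Finset.sum_filter_add_sum_filter_not s (fun p' => p'.1 = p.1)] at h1
      have h2 : ∑ p' ∈ s with p'.1 = p.1, f p' * ⟪D p, D p'⟫ = f p := by
        rw [Finset.sum_eq_single p]
        · have := (ho p.1).1 p.2
          simp only [Prod.mk.eta] at this
          rw [real_inner_self_eq_norm_sq, this]; simp
        · rintro ⟨a, b⟩ hb hne
          obtain ⟨a', b'⟩ := p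
          simp only [Finset.mem_filter] at hb
          obtain ⟨_, rfl⟩ := hb
          have := (ho a).2 (i := b') (j := b) (by rintro rfl; exact hne rfl)
          simp only at this
          rw [this, mul_zero]
        · intro h; simp [hp] at h
      have h3 : T - S p.1 = ∑ p' ∈ s with ¬ p'.1 = p.1, |f p'| := by
        rw [hT, ← Finset.sum_filter_add_sum_filter_not s (fun p' => p'.1 = p.1)]
        simp [hS]
      rw [h2] at h1
      rw [eq_neg_of_add_eq_zero_left h1, abs_neg, h3, Finset.mul_sum]
      refine (Finset.abs_sum_le_sum_abs _ _).trans (Finset.sum_le_sum fun p' hp' => ?_)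
      rw [abs_mul, mul_comm]
      simp only [Finset.mem_filter] at hp'
      exact mul_le_mul_of_nonneg_right (hμ _ _ (Ne.symm hp'.2)) (abs_nonneg _)
    have hl : ∀ l, S l ≤ (({p ∈ s | p.1 = l}.card : ℕ) : ℝ) * (μ * (T - S l)) := by
      intro l
      rw [← nsmul_eq_mul]
      refine Finset.sum_le_card_nsmul _ _ _ fun p hp => ?_
      simp only [Finset.mem_filter] at hp
      have := hbound p hp.1
      rwa [hp.2] at this
    have hT0 : 0 ≤ T := Finset.sum_nonneg fun _ _ => abs_nonneg _
    have hl2 : ∀ l, S l ≤ T * (1 / (q + 1) + q ^ 2 / (q + 1) ^ 2 *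
        (μ * (({p ∈ s | p.1 = l}.card : ℕ) : ℝ) - 1 / q)) := by
      intro l
      set u := μ * (({p ∈ s | p.1 = l}.card : ℕ) : ℝ) with hu
      have hu0 : 0 ≤ u := by positivity
      have h1 : S l * (1 + u) ≤ T * u := by have := hl l; rw [hu]; linarith
      have h2 : S l ≤ T * (u / (1 + u)) := by
        rw [← mul_div_assoc, le_div_iff₀ (by positivity)]; exact h1
      refine h2.trans (mul_le_mul_of_nonneg_left ?_ hT0)
      rw [div_le_iff₀ (by positivity), ← sub_nonneg]
      have : (1 / (q + 1) + q ^ 2 / (q + 1) ^ 2 * (u - 1 / q)) * (1 + u) - u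
        = (q * u - 1) ^ 2 / (q + 1) ^ 2 := by field_simp; ring
      rw [this]; positivity
    have hsum := Finset.sum_le_sum fun l (_ : l ∈ Finset.univ) => hl2 l
    rw [hST, ← Finset.mul_sum, Finset.sum_add_distrib, ← Finset.mul_sum, Finset.sum_sub_distrib,
      ← Finset.mul_sum, hcard] at hsum
    simp only [Finset.sum_const, Finset.card_univ, nsmul_eq_mul, hc] at hsum
    have h4 : (q + 1) * (1 / (q + 1)) + q ^ 2 / (q + 1) ^ 2 * (μ * s.card - (q + 1) * (1 / q)) < 1 := by
      have h5 : q ^ 2 / (q + 1) ^ 2 * (μ * s.card - (q + 1) * (1 / q)) < 0 := by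
        apply mul_neg_of_pos_of_neg (by positivity)
        rw [mul_one_div]; linarith
      rw [mul_one_div_cancel (by positivity)]; linarith
    have hT00 : T = 0 := by nlinarith
    intro p hp
    have := (Finset.sum_eq_zero_iff_of_nonneg (fun _ _ => abs_nonneg _)).1 hT00 p hp
    exact abs_eq_zero.1 this
  exact this

set_option linter.unusedSectionVars false

section Constr
variable {F : Type} [Field F] [Fintype F] [DecidableEq F] [CharP F 2]

lemma exists_chi : ∃ χ : AddChar F ℝ, χ ≠ 1 := by
  let _ : Algebra (ZMod 2) F := ZMod.algebra F 2
  have h : ¬ ∀ φ : Module.Dual (ZMod 2) F, φ (1 : F) = 0 := by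
    rw [Module.forall_dual_apply_eq_zero_iff]; exact one_ne_zero
  push Not at h
  obtain ⟨φ, hφ⟩ := h
  let ψ : AddChar (ZMod 2) ℝ := AddChar.zmodChar 2 (ζ := (-1 : ℝ)) (by norm_num)
  refine ⟨ψ.compAddMonoidHom φ.toAddMonoidHom, fun hc => ?_⟩
  have h1 := DFunLike.congr_fun hc (1 : F)
  have h2 : φ 1 = 1 := by
    generalize φ (1 : F) = z at hφ
    revert hφ; revert z; decide
  have h3 : ψ 1 = -1 := by
    rw [AddChar.zmodChar_apply]; simp [ZMod.val_one]
  have h4 : ψ (φ 1) = 1 := h1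
  rw [h2, h3] at h4
  norm_num at h4

lemma chi_sq (χ : AddChar F ℝ) (a : F) : χ a * χ a = 1 := by
  rw [← AddChar.map_add_eq_mul, CharTwo.add_self_eq_zero, AddChar.map_zero_eq_one]

lemma sum_chi_dot (χ : AddChar F ℝ) (hχ : χ ≠ 1) {ι : Type} [Fintype ι] [DecidableEq ι] (w : ι → F) :
    ∑ x : ι → F, χ (w ⬝ᵥ x) = if w = 0 then (Fintype.card F : ℝ) ^ Fintype.card ι else 0 := by
  split_ifs with h
  · subst h; simp
  · let L : (ι → F) →+ F :=
      { toFun := fun x => w ⬝ᵥ x, map_zero' := by simp, map_add' := fun x y => dotProduct_add _ _ _ }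
    refine AddChar.sum_eq_zero_of_ne_one (ψ := χ.compAddMonoidHom L) fun hc => ?_
    obtain ⟨i, hi⟩ := Function.ne_iff.1 h
    apply hχ
    ext a
    have := DFunLike.congr_fun hc (Pi.single i ((w i)⁻¹ * a))
    have h2 : χ (w ⬝ᵥ (Pi.single i ((w i)⁻¹ * a))) = 1 := this
    rw [dotProduct_single, mul_inv_cancel_left₀ hi] at h2
    simpa using h2

/-- bent sums -/
lemma bent_sum (χ : AddChar F ℝ) (hχ : χ ≠ 1) {ι : Type} [Fintype ι] [DecidableEq ι]
    (N : (ι → F) → F) (σ : ι → ι) (hσ : Function.Surjective σ) (hN0 : N 0 = 0)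
    (hN : ∀ x z, N (x + z) = N x + N z + (fun i => z (σ i)) ⬝ᵥ x) (α : F) (hα : α ≠ 0) (w : ι → F) :
    (∑ x, χ (α * N x + w ⬝ᵥ x)) ^ 2 = (Fintype.card F : ℝ) ^ Fintype.card ι := by
  have key : ∀ z : ι → F, ∑ x, χ (α * N x + w ⬝ᵥ x) * χ (α * N (x + z) + w ⬝ᵥ (x + z))
      = χ (α * N z + w ⬝ᵥ z) * ∑ x, χ ((α • fun i => z (σ i)) ⬝ᵥ x) := by
    intro z
    rw [Finset.mul_sum]
    refine Finset.sum_congr rfl fun x _ => ?_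
    rw [← AddChar.map_add_eq_mul, ← AddChar.map_add_eq_mul, hN, dotProduct_add, smul_dotProduct,
      smul_eq_mul]
    congr 1
    have h1 := CharTwo.add_self_eq_zero (α * N x)
    have h2 := CharTwo.add_self_eq_zero (w ⬝ᵥ x)
    linear_combination h1 + h2
  have hz : ∀ z : ι → F, (α • fun i => z (σ i)) = 0 ↔ z = 0 := by
    intro z
    constructor
    · intro h
      ext j
      obtain ⟨i, rfl⟩ := hσ j
      have := congrFun h i
      simpa [hα] using this
    · rintro rfl; ext; simp
  calc (∑ x, χ (α * N x + w ⬝ᵥ x)) ^ 2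
      = ∑ x, ∑ y, χ (α * N x + w ⬝ᵥ x) * χ (α * N y + w ⬝ᵥ y) := by
        rw [sq, Finset.sum_mul_sum]
    _ = ∑ x, ∑ z, χ (α * N x + w ⬝ᵥ x) * χ (α * N (x + z) + w ⬝ᵥ (x + z)) := by
        refine Finset.sum_congr rfl fun x _ => ?_
        exact (Equiv.sum_comp (Equiv.addLeft x)
          (fun y => χ (α * N x + w ⬝ᵥ x) * χ (α * N y + w ⬝ᵥ y))).symm
    _ = ∑ z, χ (α * N z + w ⬝ᵥ z) * ∑ x, χ ((α • fun i => z (σ i)) ⬝ᵥ x) := by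
        rw [Finset.sum_comm]
        exact Finset.sum_congr rfl fun z _ => key z
    _ = (Fintype.card F : ℝ) ^ Fintype.card ι := by
        simp only [sum_chi_dot χ hχ, hz]
        simp [hN0]

lemma exists_gamma : ∃ γ : F, ∀ s : F, s ^ 2 + s + γ ≠ 0 := by
  have hni : ¬ Function.Injective (fun s : F => s ^ 2 + s) := by
    intro h
    have : (0 : F) = 1 := h (by
      simp only [one_pow]; rw [CharTwo.add_self_eq_zero]; simp)
    exact zero_ne_one this
  rw [Finite.injective_iff_surjective] at hni
  simp only [Function.Surjective, not_forall, not_exists] at hni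
  obtain ⟨γ, hγ⟩ := hni
  refine ⟨γ, fun s hs => hγ s ?_⟩
  have := CharTwo.add_self_eq_zero γ
  linear_combination hs - this

/-- the quadratic form -/
def NN {m : ℕ} (γ : F) (x : Fin (m + 1) ⊕ Fin (m + 1) → F) : F :=
  (∑ i, x (Sum.inl i) * x (Sum.inr i)) + x (Sum.inl 0) ^ 2 + γ * x (Sum.inr 0) ^ 2

lemma NN_add {m : ℕ} (γ : F) (x z : Fin (m + 1) ⊕ Fin (m + 1) → F) :
    NN γ (x + z) = NN γ x + NN γ z + (fun i => z (Sum.swap i)) ⬝ᵥ x := by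
  have h2 : (2 : F) = 0 := CharTwo.two_eq_zero
  simp only [NN, dotProduct, Fintype.sum_sum_type, Pi.add_apply, Sum.swap_inl, Sum.swap_inr]
  have : ∑ i, (x (Sum.inl i) + z (Sum.inl i)) * (x (Sum.inr i) + z (Sum.inr i))
      = ∑ i, x (Sum.inl i) * x (Sum.inr i) + ∑ i, z (Sum.inl i) * z (Sum.inr i)
        + (∑ i, z (Sum.inr i) * x (Sum.inl i) + ∑ i, z (Sum.inl i) * x (Sum.inr i)) := by
    simp only [← Finset.sum_add_distrib]
    exact Finset.sum_congr rfl fun i _ => by ring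
  rw [this]
  linear_combination (x (Sum.inl 0) * z (Sum.inl 0) + γ * x (Sum.inr 0) * z (Sum.inr 0)) * h2

/-- the vectors -/
noncomputable def gg {m : ℕ} (γ : F) (χ : AddChar F ℝ) :
    Option F → (Fin (m + 1) ⊕ Fin (m + 1) → F) → (Fin (m + 1) ⊕ Fin (m + 1) → F) → ℝ
  | none, w, x => if w = x then 1 else 0
  | some a, w, x => 1 / (Fintype.card F : ℝ) ^ (m + 1) * χ (a * NN γ x + w ⬝ᵥ x)

lemma gg_orth {m : ℕ} (γ : F) (χ : AddChar F ℝ) (hχ : χ ≠ 1) (o : Option F)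
    (w w' : Fin (m + 1) ⊕ Fin (m + 1) → F) :
    ∑ x, gg γ χ o w x * gg γ χ o w' x = if w = w' then 1 else 0 := by
  cases o with
  | none => simp [gg]
  | some a =>
    have hq : (Fintype.card F : ℝ) ≠ 0 := by simp
    have : ∀ x, gg γ χ (some a) w x * gg γ χ (some a) w' x
        = (1 / (Fintype.card F : ℝ) ^ (m + 1)) ^ 2 * χ ((w - w') ⬝ᵥ x) := by
      intro x
      simp only [gg]
      have h1 := CharTwo.add_self_eq_zero (a * NN γ x)
      have h2 := CharTwo.add_self_eq_zero (w' ⬝ᵥ x)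
      have : (w - w') ⬝ᵥ x = (a * NN γ x + w ⬝ᵥ x) + (a * NN γ x + w' ⬝ᵥ x) := by
        rw [sub_dotProduct]; linear_combination -h1 - h2
      rw [this, AddChar.map_add_eq_mul χ (a * NN γ x + w ⬝ᵥ x)]
      generalize χ (a * NN γ x + w ⬝ᵥ x) = A
      generalize χ (a * NN γ x + w' ⬝ᵥ x) = B
      ring
    simp only [this, ← Finset.mul_sum, sum_chi_dot χ hχ, sub_eq_zero]
    split_ifs
    · simp only [Fintype.card_sum, Fintype.card_fin]
      field_simp; rw [← pow_mul]; ring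
    · simp

lemma gg_cross {m : ℕ} (γ : F) (χ : AddChar F ℝ) (hχ : χ ≠ 1) (o o' : Option F) (ho : o ≠ o')
    (w w' : Fin (m + 1) ⊕ Fin (m + 1) → F) :
    |∑ x, gg γ χ o w x * gg γ χ o' w' x| = 1 / (Fintype.card F : ℝ) ^ (m + 1) := by
  have hq : (0 : ℝ) < (Fintype.card F : ℝ) := by simp [Fintype.card_pos]
  have habs : ∀ a, |χ a| = 1 := fun a => by
    have := chi_sq χ a
    rw [← abs_mul_abs_self] at this
    nlinarith [abs_nonneg (χ a)]
  have hp : |1 / (Fintype.card F : ℝ) ^ (m + 1)| = 1 / (Fintype.card F : ℝ) ^ (m + 1) :=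
    abs_of_pos (by positivity)
  cases o with
  | none =>
    cases o' with
    | none => exact absurd rfl ho
    | some a =>
      simp only [gg, ite_mul, one_mul, zero_mul, Finset.sum_ite_eq, Finset.mem_univ, if_true]
      rw [abs_mul, habs, hp, mul_one]
  | some a =>
    cases o' with
    | none =>
      simp only [gg, mul_ite, mul_one, mul_zero, Finset.sum_ite_eq, Finset.mem_univ, if_true]
      rw [abs_mul, habs, hp, mul_one]
    | some b =>
      have : ∀ x, gg γ χ (some a) w x * gg γ χ (some b) w' x
        = (1 / (Fintype.card F : ℝ) ^ (m + 1)) ^ 2 * χ ((a + b) * NN γ x + (w + w') ⬝ᵥ x) := by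
        intro x
        simp only [gg]
        have : (a + b) * NN γ x + (w + w') ⬝ᵥ x
          = (a * NN γ x + w ⬝ᵥ x) + (b * NN γ x + w' ⬝ᵥ x) := by
          rw [add_dotProduct]; ring
        rw [this, AddChar.map_add_eq_mul χ (a * NN γ x + w ⬝ᵥ x)]
        generalize χ (a * NN γ x + w ⬝ᵥ x) = A
        generalize χ (b * NN γ x + w' ⬝ᵥ x) = B
        ring
      simp only [this, ← Finset.mul_sum]
      have hab : a + b ≠ 0 := fun h => ho (by rw [CharTwo.add_eq_zero.1 h])
      have hb := bent_sum χ hχ (NN γ) Sum.swap (fun i => ⟨i.swap, Sum.swap_swap i⟩)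
        (by simp [NN]) (NN_add (m := m) γ) (a + b) hab (w + w')
      have hb' : |∑ x, χ ((a + b) * NN γ x + (w + w') ⬝ᵥ x)| = (Fintype.card F : ℝ) ^ (m + 1) := by
        rw [← sq_eq_sq₀ (abs_nonneg _) (by positivity), sq_abs, hb]
        simp only [Fintype.card_sum, Fintype.card_fin]
        rw [← pow_mul]; ring
      rw [abs_mul, hb', abs_pow, hp]
      field_simp

lemma gg_dep {m : ℕ} (γ : F) (hγ : ∀ s : F, s ^ 2 + s + γ ≠ 0) (χ : AddChar F ℝ) (hχ : χ ≠ 1)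
    (x : Fin (m + 1) ⊕ Fin (m + 1) → F) :
    ∑ y : Fin m → F, gg γ χ none (Sum.elim (Fin.cons 0 y) 0) x
      = ∑ a : F, ∑ y : Fin m → F, gg γ χ (some a) (Sum.elim 0 (Fin.cons 0 y)) x := by
  have hq : (Fintype.card F : ℝ) ≠ 0 := by simp
  have hdot : ∀ y : Fin m → F, (Sum.elim (0 : Fin (m + 1) → F) (Fin.cons 0 y : Fin (m + 1) → F)) ⬝ᵥ x
      = (fun i : Fin m => x (Sum.inr i.succ)) ⬝ᵥ y := by
    intro y
    simp [dotProduct, Fintype.sum_sum_type, Fin.sum_univ_succ, mul_comm]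
  have hR : ∑ a : F, ∑ y : Fin m → F, gg γ χ (some a) (Sum.elim 0 (Fin.cons 0 y)) x
      = 1 / (Fintype.card F : ℝ) ^ (m + 1) * ((∑ a, χ (a * NN γ x)) *
        ∑ y : Fin m → F, χ ((fun i : Fin m => x (Sum.inr i.succ)) ⬝ᵥ y)) := by
    rw [Finset.sum_mul_sum, Finset.mul_sum]
    refine Finset.sum_congr rfl fun a _ => ?_
    rw [Finset.mul_sum]
    refine Finset.sum_congr rfl fun y _ => ?_
    simp only [gg]
    rw [hdot, AddChar.map_add_eq_mul]
  rw [hR, sum_chi_dot χ hχ, AddChar.sum_mulShift _ (AddChar.IsPrimitive.of_ne_one hχ)]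
  by_cases h1 : (fun i : Fin m => x (Sum.inr i.succ)) = 0
  · have h1' : ∀ i : Fin m, x (Sum.inr i.succ) = 0 := fun i => congrFun h1 i
    have hN : NN γ x = x (Sum.inl 0) * x (Sum.inr 0) + x (Sum.inl 0) ^ 2 + γ * x (Sum.inr 0) ^ 2 := by
      simp [NN, Fin.sum_univ_succ, h1']
    have hN0 : NN γ x = 0 ↔ x (Sum.inl 0) = 0 ∧ x (Sum.inr 0) = 0 := by
      rw [hN]
      constructor
      · intro h
        by_cases h0 : x (Sum.inr 0) = 0
        · rw [h0] at h
          refine ⟨?_, h0⟩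
          simpa using h
        · exfalso
          apply hγ (x (Sum.inl 0) / x (Sum.inr 0))
          field_simp
          linear_combination h
      · rintro ⟨h, h'⟩; simp [h, h']
    by_cases h2 : NN γ x = 0
    · have h3 := hN0.1 h2
      rw [if_pos h1, if_pos h2]
      rw [Finset.sum_eq_single (fun i : Fin m => x (Sum.inl i.succ))]
      · simp only [gg]
        rw [if_pos]
        · simp only [Fintype.card_fin]; field_simp; ring
        · ext i
          rcases i with i | i
          · refine Fin.cases ?_ (fun i => ?_) i <;> simp [h3.1]
          · refine Fin.cases ?_ (fun i => ?_) i <;> simp [h3.2, h1']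
      · intro y _ hy
        simp only [gg]
        rw [if_neg]
        rintro rfl
        apply hy
        ext i; simp
      · simp
    · rw [if_neg h2]
      simp only [Nat.cast_zero, zero_mul, mul_zero]
      refine Finset.sum_eq_zero fun y _ => ?_
      simp only [gg]
      rw [if_neg]
      rintro rfl
      exact h2 (hN0.2 (by simp))
  · rw [if_neg h1]
    simp only [mul_zero]
    refine Finset.sum_eq_zero fun y _ => ?_
    simp only [gg]
    rw [if_neg]
    rintro rfl
    exact h1 (by ext i; simp)

end Constr

theorem stmt0 (t r : ℕ) (ht : 0 < t) (hr : 0 < r) :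
    ∃ D : Fin (2 ^ r + 1) × Fin ((2 ^ r) ^ (2 * t)) →
        EuclideanSpace ℝ (Fin ((2 ^ r) ^ (2 * t))),
      -- `D` is a union of `q + 1` orthonormal bases of `ℝ^(q^(2t))`
      (∀ i : Fin (2 ^ r + 1),
        Orthonormal ℝ (fun j => D (i, j)) ∧
        Submodule.span ℝ (Set.range fun j => D (i, j)) = ⊤) ∧
      -- `D` is a dictionary: a family of unit vectors spanning `ℝ^(q^(2t))`
      (∀ p, ‖D p‖ = 1) ∧
      Submodule.span ℝ (Set.range D) = ⊤ ∧
      -- the mutual coherence of `D` equals `1/q^t`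
      (∀ p q, p ≠ q → |⟪D p, D q⟫| ≤ 1 / ((2 ^ r : ℝ) ^ t)) ∧
      (∃ p q, p ≠ q ∧ |⟪D p, D q⟫| = 1 / ((2 ^ r : ℝ) ^ t)) ∧
      -- the spark of `D` equals `q^t + q^(t-1)`
      (∃ s : Finset (Fin (2 ^ r + 1) × Fin ((2 ^ r) ^ (2 * t))),
        s.card = (2 ^ r) ^ t + (2 ^ r) ^ (t - 1) ∧
        ¬ LinearIndependent ℝ (fun i : s => D i)) ∧
      (∀ s : Finset (Fin (2 ^ r + 1) × Fin ((2 ^ r) ^ (2 * t))),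
        s.card < (2 ^ r) ^ t + (2 ^ r) ^ (t - 1) →
        LinearIndependent ℝ (fun i : s => D i)) := by
  classical
  obtain ⟨m, rfl⟩ : ∃ m, t = m + 1 := ⟨t - 1, by omega⟩
  obtain ⟨F, _, _, _, hF⟩ : ∃ (F : Type) (_ : Field F) (_ : Fintype F) (_ : CharP F 2),
      Fintype.card F = 2 ^ r :=
    ⟨GaloisField 2 r, inferInstance, Fintype.ofFinite _, inferInstance, by
      rw [← GaloisField.card 2 r hr.ne', @Nat.card_eq_fintype_card _ (Fintype.ofFinite _)]⟩
  have hFR : (Fintype.card F : ℝ) = 2 ^ r := by rw [hF]; push_cast; rfl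
  obtain ⟨χ, hχ⟩ := exists_chi (F := F)
  obtain ⟨γ, hγ⟩ := exists_gamma (F := F)
  have e1 : Fin (2 ^ r + 1) ≃ Option F := Fintype.equivOfCardEq (by simp [hF])
  have e2 : Fin ((2 ^ r) ^ (2 * (m + 1))) ≃ (Fin (m + 1) ⊕ Fin (m + 1) → F) :=
    Fintype.equivOfCardEq (by simp [hF]; ring)
  let D : Fin (2 ^ r + 1) × Fin ((2 ^ r) ^ (2 * (m + 1))) →
      EuclideanSpace ℝ (Fin ((2 ^ r) ^ (2 * (m + 1)))) :=
    fun p => WithLp.toLp 2 (fun k => gg γ χ (e1 p.1) (e2 p.2) (e2 k))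
  have hDapp : ∀ p k, D p k = gg γ χ (e1 p.1) (e2 p.2) (e2 k) := fun p k => rfl
  have hinner : ∀ p q, ⟪D p, D q⟫
      = ∑ x, gg γ χ (e1 p.1) (e2 p.2) x * gg γ χ (e1 q.1) (e2 q.2) x := by
    intro p q
    rw [PiLp.inner_apply, ← Equiv.sum_comp e2]
    refine Finset.sum_congr rfl fun k _ => ?_
    simp only [hDapp]
    simp [mul_comm]
  have horth : ∀ i, Orthonormal ℝ (fun j => D (i, j)) := by
    intro i
    rw [orthonormal_iff_ite]
    intro j k
    rw [hinner]
    simp only [gg_orth γ χ hχ, e2.injective.eq_iff]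
  have hspan : ∀ i, Submodule.span ℝ (Set.range fun j => D (i, j)) = ⊤ := fun i =>
    (horth i).linearIndependent.span_eq_top_of_card_eq_finrank' (by simp)
  have hcross : ∀ p q, p.1 ≠ q.1 → |⟪D p, D q⟫| = 1 / ((2 ^ r : ℝ) ^ (m + 1)) := by
    intro p q hpq
    rw [hinner, gg_cross γ χ hχ _ _ (fun h => hpq (e1.injective h)), hFR]
  have hq0 : (0 : ℝ) < 2 ^ r := by positivity
  refine ⟨D, fun i => ⟨horth i, hspan i⟩, fun p => (horth p.1).1 p.2, ?_, ?_, ?_, ?_, ?_⟩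
  · rw [eq_top_iff, ← hspan 0]
    apply Submodule.span_mono
    rintro _ ⟨j, rfl⟩
    exact ⟨(0, j), rfl⟩
  · intro p q hpq
    by_cases h : p.1 = q.1
    · obtain ⟨a, b⟩ := p
      obtain ⟨a', b'⟩ := q
      simp only at h
      subst h
      have : ⟪D (a, b), D (a, b')⟫ = 0 := (horth a).2 (fun h => hpq (by rw [h]))
      rw [this, abs_zero]; positivity
    · exact (hcross p q h).le
  · have hne : e1.symm none ≠ e1.symm (some 0) := fun h => by simpa using e1.symm.injective h
    exact ⟨(e1.symm none, e2.symm 0), (e1.symm (some 0), e2.symm 0),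
      fun h => hne (congrArg Prod.fst h), hcross _ _ hne⟩
  · let φ0 : Option F × (Fin m → F) → (Fin (m + 1) ⊕ Fin (m + 1) → F) := fun z =>
      match z with
      | (none, y) => Sum.elim (Fin.cons 0 y) 0
      | (some _, y) => Sum.elim 0 (Fin.cons 0 y)
    let φ : Option F × (Fin m → F) ↪ Fin (2 ^ r + 1) × Fin ((2 ^ r) ^ (2 * (m + 1))) :=
      ⟨fun z => (e1.symm z.1, e2.symm (φ0 z)), by
        rintro ⟨o, y⟩ ⟨o', y'⟩ h
        simp only [Prod.mk.injEq, EmbeddingLike.apply_eq_iff_eq] at h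
        obtain ⟨rfl, h⟩ := h
        congr 1
        ext i
        cases o with
        | none =>
          have := congrFun h (Sum.inl i.succ)
          simpa [φ0] using this
        | some a =>
          have := congrFun h (Sum.inr i.succ)
          simpa [φ0] using this⟩
    have hφ1 : ∀ z, e1 (φ z).1 = z.1 := fun z => e1.apply_symm_apply _
    have hφn : ∀ y, e2 (φ (none, y)).2 = Sum.elim (Fin.cons 0 y : Fin (m + 1) → F) (0 : Fin (m + 1) → F) :=
      fun y => e2.apply_symm_apply _
    have hφs : ∀ a y, e2 (φ (some a, y)).2 = Sum.elim (0 : Fin (m + 1) → F) (Fin.cons 0 y : Fin (m + 1) → F) :=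
      fun a y => e2.apply_symm_apply _
    clear_value φ
    refine ⟨Finset.univ.map φ, ?_, fun hli => ?_⟩
    · simp [hF]; ring
    · have hli' : LinearIndepOn ℝ D (Finset.univ.map φ : Set _) := hli
      rw [linearIndepOn_finset_iff] at hli'
      let f : Fin (2 ^ r + 1) × Fin ((2 ^ r) ^ (2 * (m + 1))) → ℝ :=
        fun p => if e1 p.1 = none then 1 else -1
      have h0 := hli' f ?_ (φ (none, 0)) (by simp)
      · simp [f, hφ1] at h0
      · rw [Finset.sum_map]
        ext k
        have := gg_dep γ hγ χ hχ (e2 k)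
        simp only [WithLp.ofLp_sum, WithLp.ofLp_smul, Finset.sum_apply, Pi.smul_apply, hDapp,
          WithLp.ofLp_zero, Pi.zero_apply]
        rw [Fintype.sum_prod_type, Fintype.sum_option]
        simp only [f, hφ1, hφn, hφs, if_true,
          reduceCtorEq, if_false, smul_eq_mul, one_mul, neg_mul, Finset.sum_neg_distrib]
        rw [this, add_neg_cancel]
  · intro s hs
    refine spark_lb D horth (1 / ((2 ^ r : ℝ) ^ (m + 1))) (2 ^ r) (by positivity) hq0
      (fun p q h => (hcross p q h).le) (by simp) s ?_
    have hs' : (s.card : ℝ) < (2 ^ r) ^ (m + 1) + (2 ^ r) ^ m := by exact_mod_cast hs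
    rw [one_div_mul_eq_div, div_lt_div_iff₀ (by positivity) hq0]
    calc (s.card : ℝ) * 2 ^ r < ((2 ^ r) ^ (m + 1) + (2 ^ r) ^ m) * 2 ^ r :=
          mul_lt_mul_of_pos_right hs' hq0
      _ = _ := by ring
end

section
/- Let D ⊆ ℝ^(F_{2^n}) be the dictionary consisting of all standard basis vectors e_x (x ∈ F_{2^n}) together with all vectors B_{a,b} for a ∈ F_{2^r}, b ∈ F_{2^n}. Then the spark of D is at most 2^m + 2^(m-r): namely, the 2^m + 2^(m-r) vectors {B_{a,b} : a ∈ F_{2^r}, b ∈ F_{2^m}, Tr_r^m(b) = 0} ∪ {e_x : x ∈ S} are pairwise distinct and linearly dependent over ℝ. -/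
noncomputable section

/-- The relative trace `Tr_k^l` from `F_{2^l}` to `F_{2^k}`, written as a function on an
ambient field of characteristic two: `x ↦ x + x^(2^k) + x^(2^(2k)) + ⋯ + x^(2^(l-k))`. -/
def relTr {F : Type*} [Field F] (k l : ℕ) (x : F) : F :=
  ∑ i ∈ Finset.range (l / k), x ^ 2 ^ (k * i)

/-- `(-1)^y` for `y ∈ F_2 ⊆ F`, identifying `F_2` with `{0,1}`. -/
def sgn {F : Type*} [Field F] [DecidableEq F] (y : F) : ℝ :=
  if y = 0 then 1 else -1

/-- The vector `B_{a,b} ∈ ℝ^F`, whose `x`-th coordinate is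
`(1/2^m)·(-1)^(Tr_1^m(a·x^(2^m+1)) + Tr_1^n(b·x))`. -/
def Bvec {F : Type*} [Field F] [DecidableEq F] (m n : ℕ) (a b : F) : F → ℝ :=
  fun x => (1 / 2 ^ m : ℝ) * sgn (relTr 1 m (a * x ^ (2 ^ m + 1)) + relTr 1 n (b * x))

/-- The standard basis vector `e_x` of `ℝ^F`. -/
def evec {F : Type*} [DecidableEq F] (x : F) : F → ℝ :=
  fun y => if y = x then 1 else 0

/-- The set `S = {x ∈ F_{2^n} : Tr_r^m(x^(2^m+1)) = 0 and x + x^(2^m) ∈ F_{2^r}}`. -/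
def Sset {F : Type*} [Field F] (r m : ℕ) : Set F :=
  {x | relTr r m (x ^ (2 ^ m + 1)) = 0 ∧ (x + x ^ 2 ^ m) ^ 2 ^ r = x + x ^ 2 ^ m}

namespace Spark

variable {F : Type*} [Field F]

theorem rel_mul (k c : ℕ) (hk : 0 < k) (x : F) :
    relTr k (c * k) x = ∑ i ∈ Finset.range c, x ^ 2 ^ (k * i) := by
  unfold relTr
  rw [Nat.mul_div_cancel _ hk]

theorem rel_one (m : ℕ) (x : F) :
    relTr 1 m x = ∑ i ∈ Finset.range m, x ^ 2 ^ i := by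
  unfold relTr
  simp

theorem rel_zero (k l : ℕ) : relTr k l (0 : F) = 0 := by
  unfold relTr
  apply Finset.sum_eq_zero
  intro i _
  exact zero_pow (by positivity)

theorem fix_mul {k : ℕ} {x y : F} (hx : x ^ 2 ^ k = x) (hy : y ^ 2 ^ k = y) :
    (x * y) ^ 2 ^ k = x * y := by rw [mul_pow, hx, hy]

theorem fix_iter {k : ℕ} {x : F} (hx : x ^ 2 ^ k = x) (i : ℕ) : x ^ 2 ^ (k * i) = x := by
  induction i with
  | zero => simp
  | succ i ih => rw [Nat.mul_succ, pow_add, pow_mul, ih, hx]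

theorem fix_dvd {k l : ℕ} (h : k ∣ l) {x : F} (hx : x ^ 2 ^ k = x) : x ^ 2 ^ l = x := by
  obtain ⟨c, rfl⟩ := h
  exact fix_iter hx c

theorem rel_smul (k l : ℕ) {s : F} (hs : s ^ 2 ^ k = s) (x : F) :
    relTr k l (s * x) = s * relTr k l x := by
  unfold relTr
  rw [Finset.mul_sum]
  refine Finset.sum_congr rfl fun i _ => ?_
  rw [mul_pow, fix_iter hs]

variable [CharP F 2]

theorem rel_add (k l : ℕ) (x y : F) : relTr k l (x + y) = relTr k l x + relTr k l y := by
  unfold relTr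
  rw [← Finset.sum_add_distrib]
  refine Finset.sum_congr rfl fun i _ => ?_
  rw [add_pow_char_pow]

theorem rel_pow (k l j : ℕ) (x : F) : relTr k l x ^ 2 ^ j = relTr k l (x ^ 2 ^ j) := by
  unfold relTr
  rw [sum_pow_char_pow]
  refine Finset.sum_congr rfl fun i _ => ?_
  rw [← pow_mul, ← pow_mul, mul_comm]

/-- telescoping -/
theorem rel_tele (k c : ℕ) (hk : 0 < k) (z : F) :
    relTr k (c * k) (z ^ 2 ^ k + z) = z ^ 2 ^ (c * k) + z := by
  rw [rel_mul k c hk]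
  induction c with
  | zero => simp [CharTwo.add_self_eq_zero]
  | succ c ih =>
    rw [Finset.sum_range_succ, ih, add_pow_char_pow, ← pow_mul, ← pow_add, Nat.succ_mul,
      mul_comm k c, add_comm k]
    have := CharTwo.add_self_eq_zero (z ^ 2 ^ (c * k))
    linear_combination this

theorem rel_mem {k c : ℕ} (hk : 0 < k) {x : F} (hx : x ^ 2 ^ (c * k) = x) :
    relTr k (c * k) x ^ 2 ^ k = relTr k (c * k) x := by
  rw [rel_pow]
  have h := rel_tele k c hk x
  rw [rel_add, hx, CharTwo.add_self_eq_zero] at h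
  have h2 := CharTwo.add_self_eq_zero (relTr k (c * k) x)
  linear_combination h - h2

theorem rel_trans (k c : ℕ) (hk : 0 < k) (x : F) :
    relTr 1 k (relTr k (c * k) x) = relTr 1 (c * k) x := by
  rw [rel_mul k c hk, rel_one, rel_one]
  simp_rw [sum_pow_char_pow]
  rw [Finset.sum_comm]
  induction c with
  | zero => simp
  | succ c ih =>
    rw [Finset.sum_range_succ, ih, Nat.succ_mul, Finset.sum_range_add]
    congr 1
    refine Finset.sum_congr rfl fun i _ => ?_
    rw [← pow_mul, ← pow_add, mul_comm k c]

theorem rel_two (m : ℕ) (hm : 0 < m) (x : F) : relTr m (2 * m) x = x + x ^ 2 ^ m := by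
  rw [rel_mul m 2 hm]
  simp [Finset.sum_range_succ]

theorem rel_bit {l : ℕ} {x : F} (hx : x ^ 2 ^ l = x) : relTr 1 l x = 0 ∨ relTr 1 l x = 1 := by
  have h := rel_mem (k := 1) (c := l) one_pos (x := x) (by simpa using hx)
  simp only [mul_one, pow_one] at h
  have : relTr 1 l x * (relTr 1 l x - 1) = 0 := by linear_combination h
  rcases mul_eq_zero.1 this with h | h
  · exact Or.inl h
  · exact Or.inr (sub_eq_zero.1 h)

/-- The fixed field of the `k`-th Frobenius power, as additive subgroup. -/
def Fix (F : Type*) [Field F] [CharP F 2] (k : ℕ) : AddSubgroup F where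
  carrier := {x | x ^ 2 ^ k = x}
  zero_mem' := by simp
  add_mem' := by
    intro a b ha hb
    simp only [Set.mem_setOf_eq] at *
    rw [add_pow_char_pow, ha, hb]
  neg_mem' := by
    intro a ha
    simp only [Set.mem_setOf_eq] at *
    rwa [CharTwo.neg_eq]

theorem mem_Fix {k : ℕ} {x : F} : x ∈ Fix F k ↔ x ^ 2 ^ k = x := Iff.rfl

/-- The trace as additive map. -/
def trHom (F : Type*) [Field F] [CharP F 2] (k l : ℕ) : F →+ F where
  toFun := relTr k l
  map_zero' := rel_zero k l
  map_add' := rel_add k l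

/-- The kernel of the trace on the fixed field. -/
def Ker (F : Type*) [Field F] [CharP F 2] (k l : ℕ) : AddSubgroup F := Fix F l ⊓ (trHom F k l).ker

theorem mem_Ker {k l : ℕ} {x : F} : x ∈ Ker F k l ↔ x ^ 2 ^ l = x ∧ relTr k l x = 0 := Iff.rfl

theorem count {F : Type*} [AddCommGroup F] [Finite F] (H K : AddSubgroup F) (g : F →+ F) (A B : ℕ)
    (hA : 0 < A) (hB : 0 < B) (hH : Nat.card H = A * B) (h1 : Nat.card (H ⊓ g.ker : AddSubgroup F) ≤ A)
    (h2 : Nat.card K ≤ B) (h : ∀ x ∈ H, g x ∈ K) :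
    Nat.card (H ⊓ g.ker : AddSubgroup F) = A ∧ Nat.card K = B := by
  have e1 := (g.comp H.subtype).ker.card_mul_index
  rw [AddSubgroup.index_ker, hH] at e1
  have e2 : Nat.card (g.comp H.subtype).ker = Nat.card (H ⊓ g.ker : AddSubgroup F) := by
    refine Nat.card_congr ⟨fun x => ⟨x.1.1, x.1.2, x.2⟩, fun x => ⟨⟨x.1, x.2.1⟩, x.2.2⟩, ?_, ?_⟩
    · intro x; rfl
    · intro x; rfl
  have e3 : Nat.card (g.comp H.subtype).range ≤ Nat.card K := by
    apply AddSubgroup.card_le_of_le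
    rintro _ ⟨x, rfl⟩
    exact h _ x.2
  rw [e2] at e1
  constructor <;> nlinarith

theorem card_le_of_poly [Finite F] (H : AddSubgroup F) (p : Polynomial F) (hp : p ≠ 0)
    (h : ∀ x ∈ H, p.eval x = 0) : Nat.card H ≤ p.natDegree := by
  classical
  have : (H : Set F) ⊆ (p.roots.toFinset : Set F) := by
    intro x hx
    simp [hp, h x hx]
  calc Nat.card H = (H : Set F).ncard := rfl
    _ ≤ (p.roots.toFinset : Set F).ncard := Set.ncard_le_ncard this (Finset.finite_toSet _)
    _ = p.roots.toFinset.card := Set.ncard_coe_finset _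
    _ ≤ p.roots.card := Multiset.toFinset_card_le _
    _ ≤ _ := Polynomial.card_roots' p

theorem fix_le [Finite F] (k : ℕ) (hk : 0 < k) : Nat.card (Fix F k) ≤ 2 ^ k := by
  have h1 : 1 < 2 ^ k := Nat.one_lt_two_pow hk.ne'
  refine (card_le_of_poly _ _ (FiniteField.X_pow_card_sub_X_ne_zero F h1) ?_).trans
    (FiniteField.X_pow_card_sub_X_natDegree_eq F h1).le
  intro x hx
  simp [mem_Fix.1 hx]

theorem ker_le [Finite F] (k c : ℕ) (hk : 0 < k) (hc : 0 < c) :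
    Nat.card (Ker F k (c * k)) ≤ 2 ^ (c * k - k) := by
  have hne : (∑ i ∈ Finset.range c, (Polynomial.X : Polynomial F) ^ 2 ^ (k * i)) ≠ 0 := by
    intro h
    have h := congrArg (fun p => Polynomial.coeff p 1) h
    simp only [Polynomial.finset_sum_coeff, Polynomial.coeff_X_pow, Polynomial.coeff_zero] at h
    rw [Finset.sum_eq_single 0] at h
    · simp at h
    · intro i _ hi
      rw [if_neg]
      have : 1 < 2 ^ (k * i) := Nat.one_lt_two_pow (by positivity)
      omega
    · intro h; simp at h; omega
  refine (card_le_of_poly _ _ hne ?_).trans ?_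
  · intro x hx
    have := (mem_Ker.1 hx).2
    rw [rel_mul k c hk] at this
    simpa [Polynomial.eval_finset_sum] using this
  · apply Polynomial.natDegree_sum_le_of_forall_le
    intro i hi
    rw [Polynomial.natDegree_X_pow]
    apply Nat.pow_le_pow_right (by norm_num)
    have : i + 1 ≤ c := Finset.mem_range.1 hi
    have : k * (i + 1) ≤ k * c := Nat.mul_le_mul_left _ this
    rw [mul_comm c k]
    rw [Nat.mul_succ] at this
    omega

theorem count_tr [Finite F] (k c : ℕ) (hk : 0 < k) (hc : 0 < c)
    (h : Nat.card (Fix F (c * k)) = 2 ^ (c * k)) :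
    Nat.card (Ker F k (c * k)) = 2 ^ (c * k - k) ∧ Nat.card (Fix F k) = 2 ^ k := by
  refine count (Fix F (c * k)) (Fix F k) (trHom F k (c * k)) _ _ (by positivity) (by positivity)
    ?_ (ker_le k c hk hc) (fix_le k hk) ?_
  · rw [h, ← pow_add]
    congr 1
    have : k ≤ c * k := Nat.le_mul_of_pos_left _ hc
    omega
  · intro x hx
    exact rel_mem hk hx

theorem nondeg [Finite F] (l : ℕ) (hl : 0 < l) (h : Nat.card (Fix F l) = 2 ^ l) {b : F}
    (hb : b ^ 2 ^ l = b) (hz : ∀ x : F, x ^ 2 ^ l = x → relTr 1 l (b * x) = 0) : b = 0 := by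
  by_contra hne
  have h1 := (count_tr (F := F) 1 l one_pos hl (by simpa using h)).1
  have : Ker F 1 (l * 1) = Fix F l := by
    ext x
    rw [mem_Ker, mem_Fix, mul_one]
    refine ⟨fun h => h.1, fun hx => ⟨hx, ?_⟩⟩
    have := hz (b⁻¹ * x) (fix_mul (by rw [inv_pow, hb]) hx)
    rwa [mul_inv_cancel_left₀ hne] at this
  rw [this, h, mul_one] at h1
  have := Nat.pow_right_injective (le_refl 2) h1
  omega

variable [DecidableEq F]

theorem sgn_sum {G : Type*} [AddCommGroup G] (s : Finset G)
    (h2 : ∀ u : G, u + u = 0) (hs : ∀ u ∈ s, ∀ v ∈ s, u + v ∈ s) (φ : G → F)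
    (hφ : ∀ u ∈ s, ∀ v ∈ s, φ (u + v) = φ u + φ v) (hb : ∀ u ∈ s, φ u = 0 ∨ φ u = 1)
    (hne : ∃ u ∈ s, φ u ≠ 0) : ∑ u ∈ s, sgn (φ u) = 0 := by
  obtain ⟨u0, hu0, hne⟩ := hne
  have h1 : φ u0 = 1 := (hb u0 hu0).resolve_left hne
  have h11 : (1 : F) + 1 = 0 := CharTwo.add_self_eq_zero 1
  refine Finset.sum_involution (fun u _ => u + u0) ?_ ?_ ?_ ?_
  · intro u hu
    rw [hφ u hu u0 hu0, h1]
    rcases hb u hu with h | h <;> simp [h, sgn, h11]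
  · intro u hu _ h
    have : u0 = 0 := by simpa using h
    subst this
    have := hφ 0 hu0 0 hu0
    rw [add_zero, h1, h11] at this
    exact one_ne_zero this
  · intro u hu
    exact hs u hu u0 hu0
  · intro u hu
    rw [add_assoc, h2, add_zero]

/-- The set `S` is the kernel of the relative trace. -/
theorem mem_S_iff (r t : ℕ) (hr : 0 < r) (x : F) :
    x ∈ (Sset r (t * r) : Set F) ↔ x ∈ Ker F r (t * r) := by
  rw [mem_Ker]
  show _ ∧ _ ↔ _
  have key : ∀ z : F, relTr r (t * r) (z ^ 2) = 0 ↔ relTr r (t * r) z = 0 := by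
    intro z
    have := rel_pow r (t * r) 1 z
    rw [pow_one] at this
    rw [← this]
    simp
  have hq : ∀ x : F, x ^ 2 ^ (t * r) = x → x ^ (2 ^ (t * r) + 1) = x ^ 2 := by
    intro x hx
    rw [pow_succ, hx, sq]
  constructor
  · rintro ⟨h1, h2⟩
    have hx : x ^ 2 ^ (t * r) = x := by
      by_contra hne
      obtain ⟨s, hs⟩ : ∃ s, s = x + x ^ 2 ^ (t * r) := ⟨_, rfl⟩
      rw [← hs] at h2
      have hs0 : s ≠ 0 := by
        intro h
        rw [h] at hs
        apply hne
        have := CharTwo.add_self_eq_zero x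
        linear_combination -hs - this
      have hsm : s ^ 2 ^ (t * r) = s := fix_dvd (Dvd.intro_left _ rfl) h2
      obtain ⟨y, rfl⟩ : ∃ y, x = s * y := ⟨s⁻¹ * x, by rw [mul_inv_cancel_left₀ hs0]⟩
      rw [mul_pow, hsm] at hs
      have hy : y ^ 2 ^ (t * r) + y = 1 := by
        apply mul_left_cancel₀ hs0
        linear_combination -hs
      have hN : (s * y) ^ (2 ^ (t * r) + 1) = s ^ 2 * (y ^ 2 + y) := by
        rw [pow_succ, mul_pow, hsm]
        have := CharTwo.add_self_eq_zero y
        linear_combination s ^ 2 * y * (hy - this)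
      have hs2 : (s ^ 2) ^ 2 ^ r = s ^ 2 := by rw [pow_right_comm, h2]
      rw [hN, rel_smul _ _ hs2] at h1
      have h3 := (mul_eq_zero.1 h1).resolve_left (pow_ne_zero 2 hs0)
      have h4 := rel_trans r t hr (y ^ 2 + y)
      rw [h3, rel_zero] at h4
      have h5 := rel_tele 1 (t * r) one_pos y
      rw [mul_one, pow_one, ← h4, hy] at h5
      exact zero_ne_one h5
    refine ⟨hx, ?_⟩
    rw [hq x hx] at h1
    exact (key x).1 h1
  · rintro ⟨hx, h⟩
    refine ⟨?_, ?_⟩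
    · rw [hq x hx]
      exact (key x).2 h
    · rw [hx, CharTwo.add_self_eq_zero]
      simp

/-- The orthogonal complement of the kernel of the trace is the small field. -/
theorem perp [Finite F] (r t : ℕ) (hr : 0 < r) (ht : 0 < t)
    (h : Nat.card (Fix F (t * r)) = 2 ^ (t * r)) {y : F} (hy : y ^ 2 ^ (t * r) = y)
    (hz : ∀ b ∈ Ker F r (t * r), relTr 1 (t * r) (b * y) = 0) : y ^ 2 ^ r = y := by
  have hle : r ≤ t * r := Nat.le_mul_of_pos_left _ ht
  have h0 : y ^ 2 ^ r + y = 0 := by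
    refine nondeg (t * r) (by positivity) h ?_ ?_
    · rw [add_pow_char_pow, pow_right_comm, hy]
    · intro w hw
      have hzm : (w ^ 2 ^ (t * r - r)) ^ 2 ^ (t * r) = w ^ 2 ^ (t * r - r) := by
        rw [pow_right_comm, hw]
      obtain ⟨z, hzz⟩ : ∃ z, z = w ^ 2 ^ (t * r - r) := ⟨_, rfl⟩
      rw [← hzz] at hzm
      have hzw : z ^ 2 ^ r = w := by
        rw [hzz, ← pow_mul, ← pow_add, Nat.sub_add_cancel hle, hw]
      have hb := hz (z ^ 2 ^ r + z) (by
        rw [mem_Ker, add_pow_char_pow, pow_right_comm, hzm, rel_tele r t hr, hzm]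
        exact ⟨rfl, CharTwo.add_self_eq_zero z⟩)
      have e := rel_pow 1 (t * r) r (z * y)
      have hbit : relTr 1 (t * r) (z * y) ^ 2 ^ r = relTr 1 (t * r) (z * y) := by
        rcases rel_bit (fix_mul hzm hy) with h | h <;> rw [h] <;> simp
      rw [hbit, mul_pow, hzw] at e
      rw [hzw, add_mul, rel_add, e, ← rel_add] at hb
      rw [← hb]
      congr 1
      ring
  have := CharTwo.add_self_eq_zero y
  linear_combination h0 - this

end Spark

open Spark in
theorem stmt14 (t r : ℕ) (ht : 0 < t) (hr : 0 < r) (m n : ℕ) (hm : m = t * r)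
    (hn : n = 2 * m) (F : Type*) [Field F] [Fintype F] [DecidableEq F]
    (hF : Fintype.card F = 2 ^ n) :
    -- the subfamily `{B_{a,b} : a ∈ F_{2^r}, b ∈ F_{2^m}, Tr_r^m(b) = 0} ∪ {e_x : x ∈ S}`
    let f : ({p : F × F // p.1 ^ 2 ^ r = p.1 ∧ p.2 ^ 2 ^ m = p.2 ∧ relTr r m p.2 = 0} ⊕
          {x : F // x ∈ (Sset r m : Set F)}) → F → ℝ :=
      Sum.elim (fun p => Bvec m n p.1.1 p.1.2) (fun x => evec x.1)
    -- it consists of `2^m + 2^(m-r)` pairwise distinct vectors and is linearly dependent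
    Function.Injective f ∧
    Nat.card ({p : F × F // p.1 ^ 2 ^ r = p.1 ∧ p.2 ^ 2 ^ m = p.2 ∧ relTr r m p.2 = 0} ⊕
        {x : F // x ∈ (Sset r m : Set F)}) = 2 ^ m + 2 ^ (m - r) ∧
    ¬ LinearIndependent ℝ f := by
  intro f
  haveI : CharP F 2 := charP_of_card_eq_prime_pow hF
  have hmpos : 0 < m := by rw [hm]; positivity
  have hle : r ≤ m := by rw [hm]; exact Nat.le_mul_of_pos_left _ ht
  have hfr : ∀ x : F, x ^ 2 ^ n = x := fun x => by rw [← hF]; exact FiniteField.pow_card x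
  have hcn : Nat.card (Fix F n) = 2 ^ n := by
    rw [← hF, ← Nat.card_eq_fintype_card]
    exact Nat.card_congr ⟨fun x => x.1, fun x => ⟨x, hfr x⟩, fun _ => rfl, fun _ => rfl⟩
  have hcm : Nat.card (Fix F m) = 2 ^ m := (count_tr m 2 hmpos two_pos (by rw [← hn]; exact hcn)).2
  obtain ⟨hcK, hcr⟩ := count_tr (F := F) r t hr ht (by rw [← hm]; exact hcm)
  rw [← hm] at hcK
  have hS : ∀ x : F, x ∈ (Sset r m : Set F) ↔ x ∈ Ker F r m := by
    rw [hm]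
    exact mem_S_iff r t hr
  have hrm : r ∣ m := by rw [hm]; exact Dvd.intro_left _ rfl
  -- cardinalities
  have hcS : Nat.card {x : F // x ∈ (Sset r m : Set F)} = 2 ^ (m - r) := by
    rw [← hcK]
    exact Nat.card_congr (Equiv.subtypeEquivRight hS)
  have hcW : Nat.card {p : F × F // p.1 ^ 2 ^ r = p.1 ∧ p.2 ^ 2 ^ m = p.2 ∧ relTr r m p.2 = 0}
      = 2 ^ m := by
    have : Nat.card (Fix F r × Ker F r m) = 2 ^ m := by
      rw [Nat.card_prod, hcr, hcK, ← pow_add]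
      congr 1
      omega
    refine Eq.trans ?_ this
    exact Nat.card_congr ⟨fun p => (⟨p.1.1, p.2.1⟩, ⟨p.1.2, p.2.2⟩),
      fun q => ⟨(q.1.1, q.2.1), q.1.2, q.2.2⟩, fun _ => rfl, fun _ => rfl⟩
  -- the exponent
  have hnorm : ∀ x : F, (x ^ (2 ^ m + 1)) ^ 2 ^ m = x ^ (2 ^ m + 1) := by
    intro x
    have h2 : (x ^ 2 ^ m) ^ 2 ^ m = x := by
      rw [← pow_mul, ← pow_add, ← two_mul, ← hn, hfr]
    rw [pow_succ, mul_pow, h2, mul_comm]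
  have htrm : ∀ x : F, (x + x ^ 2 ^ m) ^ 2 ^ m = x + x ^ 2 ^ m := by
    intro x
    rw [add_pow_char_pow, ← pow_mul, ← pow_add, ← two_mul, ← hn, hfr, add_comm]
  have hE1 : ∀ a x : F, a ^ 2 ^ r = a → relTr 1 m (a * x ^ (2 ^ m + 1)) =
      relTr 1 r (a * relTr r m (x ^ (2 ^ m + 1))) := by
    intro a x ha
    rw [← rel_smul _ _ ha, hm, rel_trans r t hr]
  have hE2 : ∀ b x : F, b ^ 2 ^ m = b → relTr 1 n (b * x) = relTr 1 m (b * (x + x ^ 2 ^ m)) := by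
    intro b x hb
    rw [← rel_two m hmpos, ← rel_smul _ _ hb, hn, rel_trans m 2 hmpos]
  have hb1 : ∀ a x : F, a ^ 2 ^ r = a → relTr 1 m (a * x ^ (2 ^ m + 1)) = 0 ∨
      relTr 1 m (a * x ^ (2 ^ m + 1)) = 1 := fun a x ha =>
    rel_bit (fix_mul (fix_dvd hrm ha) (hnorm x))
  have hb2 : ∀ b x : F, relTr 1 n (b * x) = 0 ∨ relTr 1 n (b * x) = 1 := fun b x =>
    rel_bit (hfr _)
  have h11 : (1 : F) + 1 = 0 := CharTwo.add_self_eq_zero 1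
  have hbit : ∀ a b x : F, a ^ 2 ^ r = a →
      relTr 1 m (a * x ^ (2 ^ m + 1)) + relTr 1 n (b * x) = 0 ∨
      relTr 1 m (a * x ^ (2 ^ m + 1)) + relTr 1 n (b * x) = 1 := by
    intro a b x ha
    rcases hb1 a x ha with h | h <;> rcases hb2 b x with h' | h' <;> rw [h, h'] <;> simp [h11]
  have hsgn : ∀ u v : F, (u = 0 ∨ u = 1) → (v = 0 ∨ v = 1) → sgn u = sgn v → u = v := by
    intro u v hu hv h
    rcases hu with rfl | rfl <;> rcases hv with rfl | rfl <;> simp [sgn] at h ⊢ <;> norm_num at h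
  have hsgn0 : ∀ u : F, sgn u ≠ 0 := by
    intro u
    unfold sgn
    split_ifs <;> norm_num
  have h2m : (1 / 2 ^ m : ℝ) ≠ 0 := by positivity
  refine ⟨?_, ?_, ?_⟩
  · -- injectivity
    have hBe : ∀ (a b x : F), Bvec m n a b ≠ evec x := by
      intro a b x h
      have hx := congrFun h (x + 1)
      have : evec x (x + 1) = 0 := by simp [evec]
      rw [this] at hx
      exact mul_ne_zero h2m (hsgn0 _) hx
    rintro (⟨⟨a, b⟩, ha, hb, hb'⟩ | ⟨x, hx⟩) (⟨⟨a', b'⟩, ha', hb2', hb3'⟩ | ⟨x', hx'⟩) h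
    · change Bvec m n a b = Bvec m n a' b' at h
      dsimp only at ha hb hb' ha' hb2' hb3'
      have hx : ∀ x : F, relTr 1 m (a * x ^ (2 ^ m + 1)) + relTr 1 n (b * x) =
          relTr 1 m (a' * x ^ (2 ^ m + 1)) + relTr 1 n (b' * x) := fun x =>
        hsgn _ _ (hbit a b x ha) (hbit a' b' x ha') (mul_left_cancel₀ h2m (congrFun h x))
      have ham := fix_dvd hrm ha
      have ham' := fix_dvd hrm ha'
      have haa : a + a' = 0 := by
        refine nondeg m hmpos hcm (by rw [add_pow_char_pow, ham, ham']) ?_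
        intro w hw
        have hzm : (w ^ 2 ^ (m - 1)) ^ 2 ^ m = w ^ 2 ^ (m - 1) := by
          rw [pow_right_comm, hw]
        obtain ⟨z, hzz⟩ : ∃ z, z = w ^ 2 ^ (m - 1) := ⟨_, rfl⟩
        rw [← hzz] at hzm
        have hzw : z ^ 2 = w := by
          rw [hzz, ← pow_mul, ← pow_succ, Nat.sub_add_cancel hmpos, hw]
        have := hx z
        rw [hE2 b z hb, hE2 b' z hb2', hzm, CharTwo.add_self_eq_zero, mul_zero, mul_zero,
          rel_zero, add_zero, add_zero, pow_succ, hzm, ← sq, hzw] at this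
        rw [add_mul, rel_add, this, CharTwo.add_self_eq_zero]
      have haa' : a = a' := by
        have := CharTwo.add_self_eq_zero a'
        linear_combination haa - this
      subst haa'
      have hbb : b + b' = 0 := by
        refine nondeg n (by omega) hcn (hfr _) ?_
        intro w _
        rw [add_mul, rel_add, add_left_cancel (hx w), CharTwo.add_self_eq_zero]
      have hbb' : b = b' := by
        have := CharTwo.add_self_eq_zero b'
        linear_combination hbb - this
      subst hbb'
      rfl
    · exact absurd h (hBe a b x')
    · exact absurd h.symm (hBe a' b' x)
    · change evec x = evec x' at h
      have := congrFun h x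
      have hxx : x = x' := by
        by_contra hne
        simp [evec, hne] at this
      subst hxx
      rfl
  · rw [Nat.card_sum, hcS, hcW]
  · classical
    rw [Fintype.not_linearIndependent_iff]
    refine ⟨Sum.elim (fun _ => 1) (fun _ => -1), ?_, Sum.inl ⟨(0, 0), by simp [rel_zero]⟩, by simp⟩
    rw [Fintype.sum_sum_type]
    ext x
    simp only [f, Sum.elim_inl, Sum.elim_inr, one_smul, Pi.add_apply, Finset.sum_apply,
      Pi.smul_apply, Pi.zero_apply, smul_eq_mul, neg_mul, one_mul, Finset.sum_neg_distrib]
    have hev : ∑ c : {x : F // x ∈ (Sset r m : Set F)}, evec c.1 x =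
        if x ∈ (Sset r m : Set F) then 1 else 0 := by
      unfold evec
      split_ifs with h
      · rw [Finset.sum_eq_single ⟨x, h⟩]
        · simp
        · intro y _ hy
          rw [if_neg]
          rintro rfl
          exact hy rfl
        · simp
      · apply Finset.sum_eq_zero
        intro y _
        rw [if_neg]
        rintro rfl
        exact h y.2
    rw [hev]
    unfold Bvec
    rw [← Finset.mul_sum]
    split_ifs with h
    · have : ∀ p : {p : F × F // p.1 ^ 2 ^ r = p.1 ∧ p.2 ^ 2 ^ m = p.2 ∧ relTr r m p.2 = 0},
          sgn (relTr 1 m (p.1.1 * x ^ (2 ^ m + 1)) + relTr 1 n (p.1.2 * x)) = 1 := by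
        rintro ⟨⟨a, b⟩, ha, hb, hb'⟩
        dsimp only at ha hb hb' ⊢
        have e2 : relTr 1 m (b * (x + x ^ 2 ^ m)) = 0 := by
          have hx2 := h.2
          have e3 : relTr 1 r (relTr r m ((x + x ^ 2 ^ m) * b)) =
              relTr 1 m ((x + x ^ 2 ^ m) * b) := by
            rw [hm]; exact rel_trans r t hr _
          rw [mul_comm, ← e3, rel_smul _ _ hx2, hb', mul_zero, rel_zero]
        rw [hE1 a x ha, hE2 b x hb, h.1, mul_zero, rel_zero, e2, add_zero]
        simp [sgn]
      rw [Finset.sum_congr rfl (fun p _ => this p), Finset.sum_const, Finset.card_univ,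
        ← Nat.card_eq_fintype_card, hcW]
      simp
    · have hsum : ∑ p : {p : F × F // p.1 ^ 2 ^ r = p.1 ∧ p.2 ^ 2 ^ m = p.2 ∧ relTr r m p.2 = 0},
          sgn (relTr 1 m (p.1.1 * x ^ (2 ^ m + 1)) + relTr 1 n (p.1.2 * x)) = 0 := by
        rw [← Finset.sum_subtype (Finset.univ.filter fun p : F × F =>
          p.1 ^ 2 ^ r = p.1 ∧ p.2 ^ 2 ^ m = p.2 ∧ relTr r m p.2 = 0) (by simp)
          (fun p : F × F => sgn (relTr 1 m (p.1 * x ^ (2 ^ m + 1)) + relTr 1 n (p.2 * x)))]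
        apply sgn_sum
        · intro u
          ext <;> exact CharTwo.add_self_eq_zero _
        · intro u hu v hv
          simp only [Finset.mem_filter, Finset.mem_univ, true_and, Prod.fst_add, Prod.snd_add]
            at hu hv ⊢
          refine ⟨?_, ?_, ?_⟩
          · rw [add_pow_char_pow, hu.1, hv.1]
          · rw [add_pow_char_pow, hu.2.1, hv.2.1]
          · rw [rel_add, hu.2.2, hv.2.2, add_zero]
        · intro u _ v _
          simp only [Prod.fst_add, Prod.snd_add, add_mul, rel_add]
          ring
        · intro u hu
          simp only [Finset.mem_filter, Finset.mem_univ, true_and] at hu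
          exact hbit _ _ x hu.1
        · by_contra hall
          push Not at hall
          simp only [Finset.mem_filter, Finset.mem_univ, true_and, Prod.forall] at hall
          apply h
          constructor
          · refine nondeg r hr hcr ?_ ?_
            · have := rel_mem (k := r) (c := t) hr (x := x ^ (2 ^ m + 1)) (by
                rw [← hm]; exact hnorm x)
              rwa [← hm] at this
            · intro a ha
              have := hall a 0 ⟨ha, by simp, rel_zero _ _⟩
              rwa [zero_mul, rel_zero, add_zero, hE1 a x ha, mul_comm] at this
          · refine perp r t hr ht (by rw [← hm]; exact hcm) (by rw [← hm]; exact htrm x) ?_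
            rw [← hm]
            intro b hb
            have := hall 0 b ⟨by simp, hb.1, hb.2⟩
            rwa [zero_mul, rel_zero, zero_add, hE2 b x hb.1] at this
      rw [hsum]
      simp
end
end
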